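/- There exist finite connected simple graphs G and G′ with the same number of vertices and the same number of edges such that G and G′ have the same two-variable zeta function (for every pair of integers (d, r), the number of divisor classes of degree d and Baker–Norine rank r on G equals that number on G′) and the Jacobians Jac(G) and Jac(G′) are isomorphic as abelian groups, and yet T_G ≠ T_{G′} as polynomials. -/

import Mathlib

open scoped Classical

namespace BNGraph

variable {V : Type} [Fintype V]

/-- The degree of a divisor `D : V → ℤ`: the sum of its values. -/
def degSum (D : V → ℤ) : ℤ := ∑ v, D v

/-- A divisor is effective if all its values are nonnegative. -/
def Effective (D : V → ℤ) : Prop := ∀ v, 0 ≤ D v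

/-- The combinatorial Laplacian of a graph, as a homomorphism on divisors. -/
noncomputable def lap (G : SimpleGraph V) : (V → ℤ) →+ (V → ℤ) where
  toFun f := fun v => (G.degree v : ℤ) * f v - ∑ w ∈ G.neighborFinset v, f w
  map_zero' := by
    funext v; simp
  map_add' f g := by
    funext v
    simp only [Pi.add_apply, Finset.sum_add_distrib]
    ring

/-- The subgroup of principal divisors: the image of the Laplacian. -/
noncomputable def Principal (G : SimpleGraph V) : AddSubgroup (V → ℤ) := (lap G).range

/-- Linear equivalence of divisors. -/
def LinEquiv (G : SimpleGraph V) (D D' : V → ℤ) : Prop := D - D' ∈ Principal G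

/-- A divisor is winnable if it is linearly equivalent to an effective divisor. -/
def Winnable (G : SimpleGraph V) (D : V → ℤ) : Prop :=
  ∃ E : V → ℤ, Effective E ∧ LinEquiv G D E

/-- The Baker–Norine rank of a divisor: the largest `r ≥ 0` such that `D - E` is
winnable for every effective divisor `E` of degree `r`, or `-1` if there is no such `r`
(equivalently, if `D` itself is not winnable). -/
noncomputable def bnRank (G : SimpleGraph V) (D : V → ℤ) : ℤ :=
  sSup {r : ℤ | r = -1 ∨ (0 ≤ r ∧
    ∀ E : V → ℤ, Effective E → degSum E = r → Winnable G (D - E))}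

/-- The Picard group of a graph: divisors modulo principal divisors. -/
abbrev Pic (G : SimpleGraph V) : Type _ := (V → ℤ) ⧸ Principal G

/-- The number of divisor classes of degree `d` and Baker–Norine rank `r`. -/
noncomputable def numClasses (G : SimpleGraph V) (d r : ℤ) : ℕ :=
  Set.ncard {c : Pic G | ∃ D : V → ℤ,
    QuotientAddGroup.mk' (Principal G) D = c ∧ degSum D = d ∧ bnRank G D = r}

/-- Two graphs have the same two-variable zeta function iff for every degree `d` and
rank `r` they have the same number of divisor classes of degree `d` and rank `r`. -/
def SameZeta {W : Type} [Fintype W] (G : SimpleGraph V) (G' : SimpleGraph W) : Prop :=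
  ∀ d r : ℤ, numClasses G d r = numClasses G' d r

/-- Degree as a homomorphism on divisors. -/
def degHom : (V → ℤ) →+ ℤ where
  toFun := degSum
  map_zero' := by simp [degSum]
  map_add' f g := by simp [degSum, Finset.sum_add_distrib]

/-- The subgroup of divisors of degree zero. -/
def Deg0 (V : Type) [Fintype V] : AddSubgroup (V → ℤ) := (degHom (V := V)).ker

/-- The Jacobian of a graph: divisor classes of degree zero. -/
noncomputable abbrev Jac (G : SimpleGraph V) : Type _ :=
  Deg0 V ⧸ ((Principal G).addSubgroupOf (Deg0 V))

/-- The number of connected components of the spanning subgraph with edge set `A`. -/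
noncomputable def numComponents (V : Type) [Fintype V] (A : Set (Sym2 V)) : ℕ :=
  Nat.card (SimpleGraph.fromEdgeSet A).ConnectedComponent

/-- The number of edges of a graph. -/
noncomputable def edgeCount (G : SimpleGraph V) : ℕ := Nat.card G.edgeSet

open MvPolynomial in
/-- The Tutte polynomial of `G`, as a polynomial in `ℤ[x, y]` with `x = X 0`, `y = X 1`:
`T_G(x,y) = Σ_{A ⊆ E(G)} (x−1)^(c(A)−c(E(G))) (y−1)^(c(A)+|A|−|V(G)|)`. -/
noncomputable def tutte (G : SimpleGraph V) : MvPolynomial (Fin 2) ℤ :=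
  ∑ A ∈ G.edgeFinset.powerset,
    (X 0 - 1) ^ (numComponents V ↑A - numComponents V G.edgeSet) *
    (X 1 - 1) ^ (numComponents V ↑A + A.card - Fintype.card V)


/-! ### Weighted data of a graph with cyclic Jacobian of order 24 -/

/-- The character of the divisor group attached to the weights `a`. -/
def chi (a : Fin 8 → ZMod 24) : (Fin 8 → ℤ) →+ ZMod 24 where
  toFun D := ∑ v, (D v : ZMod 24) * a v
  map_zero' := by simp
  map_add' f g := by simp [add_mul, Finset.sum_add_distrib]

/-- The divisor of a single vertex. -/
def dl (v : Fin 8) : Fin 8 → ℤ := Pi.single v 1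

lemma chi_dl (a : Fin 8 → ZMod 24) (v : Fin 8) : chi a (dl v) = a v := by
  simp only [chi, dl, AddMonoidHom.coe_mk, ZeroHom.coe_mk]
  rw [Finset.sum_eq_single v]
  · simp
  · intro b _ hb
    simp [Pi.single_eq_of_ne hb]
  · simp

lemma deg_dl (v : Fin 8) : degHom (dl v) = 1 := by
  change ∑ w, dl v w = 1
  simp [dl]

lemma degSum_eq (D : Fin 8 → ℤ) : degSum D = degHom D := rfl

lemma eff_dl (v : Fin 8) : Effective (dl v) := by
  intro w
  by_cases h : w = v
  · subst h; simp [dl]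
  · simp [dl, Pi.single_eq_of_ne h]

lemma eff_zero_of_deg {E : Fin 8 → ℤ} (hE : Effective E) (h : degHom E = 0) : E = 0 := by
  funext v
  have := (Finset.sum_eq_zero_iff_of_nonneg (fun i _ => hE i)).1
    (show ∑ w, E w = 0 from h) v (Finset.mem_univ v)
  simpa using this

lemma eff_nonneg {E : Fin 8 → ℤ} (hE : Effective E) : 0 ≤ degHom E :=
  show 0 ≤ ∑ w, E w from Finset.sum_nonneg (fun i _ => hE i)

lemma eff_one {E : Fin 8 → ℤ} (hE : Effective E) (h : degHom E = 1) : ∃ v, E = dl v := by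
  have hne : ∃ v, E v ≠ 0 := by
    by_contra hcon
    push Not at hcon
    have : E = 0 := funext hcon
    rw [this] at h
    simp at h
  obtain ⟨v, hv⟩ := hne
  refine ⟨v, ?_⟩
  have h1 : 1 ≤ E v := by
    have := hE v
    omega
  have h2 : Effective (E - dl v) := by
    intro w
    by_cases hw : w = v
    · subst hw; simp [dl]; omega
    · simpa [dl, Pi.single_eq_of_ne hw] using hE w
  have h3 := eff_zero_of_deg h2 (by rw [map_sub, h, deg_dl]; rfl)
  exact sub_eq_zero.1 h3

/-- The data needed to compute ranks on a genus two graph. -/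
structure Data (G : SimpleGraph (Fin 8)) (a : Fin 8 → ZMod 24) (k : ZMod 24) : Prop where
  prin : ∀ D, D ∈ Principal G ↔ degHom D = 0 ∧ chi a D = 0
  two : ∀ x, ∃ v w, a v + a w = x
  a0 : a 0 = 0
  a1 : a 1 = 1
  miss : ∃ t, ∀ v, a v ≠ t
  spec : ∀ x, (∀ v, ∃ w, a w = x - a v) ↔ x = k

section
variable {G : SimpleGraph (Fin 8)} {a : Fin 8 → ZMod 24} {k : ZMod 24}

lemma win_iff (H : Data G a k) (D : Fin 8 → ℤ) :
    Winnable G D ↔ ∃ E, Effective E ∧ degHom E = degHom D ∧ chi a E = chi a D := by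
  unfold Winnable LinEquiv
  refine exists_congr fun E => and_congr_right fun _ => ?_
  rw [H.prin, map_sub, map_sub, sub_eq_zero, sub_eq_zero, eq_comm, @eq_comm _ (chi a D)]

lemma not_win_neg (H : Data G a k) {D : Fin 8 → ℤ} (h : degHom D < 0) : ¬ Winnable G D := by
  rw [win_iff H]
  rintro ⟨E, hE, h1, _⟩
  have := eff_nonneg hE
  omega

lemma win_zero (H : Data G a k) {D : Fin 8 → ℤ} (h : degHom D = 0) :
    Winnable G D ↔ chi a D = 0 := by
  rw [win_iff H]
  constructor
  · rintro ⟨E, hE, h1, h2⟩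
    rw [← h2, eff_zero_of_deg hE (h1.trans h), map_zero]
  · intro h2
    exact ⟨0, fun _ => le_rfl, by rw [h, map_zero], by rw [h2, map_zero]⟩

lemma win_one (H : Data G a k) {D : Fin 8 → ℤ} (h : degHom D = 1) :
    Winnable G D ↔ ∃ v, a v = chi a D := by
  rw [win_iff H]
  constructor
  · rintro ⟨E, hE, h1, h2⟩
    obtain ⟨v, rfl⟩ := eff_one hE (h1.trans h)
    exact ⟨v, by rw [← h2, chi_dl]⟩
  · rintro ⟨v, hv⟩
    exact ⟨dl v, eff_dl v, by rw [h, deg_dl], by rw [chi_dl, hv]⟩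

lemma eff_nsmul {E : Fin 8 → ℤ} (hE : Effective E) (n : ℕ) : Effective (n • E) := by
  intro v
  simp only [Pi.smul_apply, nsmul_eq_mul]
  exact mul_nonneg (by positivity) (hE v)

lemma eff_add {E F : Fin 8 → ℤ} (hE : Effective E) (hF : Effective F) : Effective (E + F) :=
  fun v => add_nonneg (hE v) (hF v)

lemma exE (H : Data G a k) {e : ℤ} (he : 2 ≤ e) (y : ZMod 24) :
    ∃ E, Effective E ∧ degHom E = e ∧ chi a E = y := by
  obtain ⟨v, w, hvw⟩ := H.two y
  refine ⟨(e - 2).toNat • dl 0 + (dl v + dl w),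
    eff_add (eff_nsmul (eff_dl 0) _) (eff_add (eff_dl v) (eff_dl w)), ?_, ?_⟩
  · rw [map_add, map_add, map_nsmul, deg_dl, deg_dl, deg_dl, nsmul_eq_mul]
    omega
  · rw [map_add, map_add, map_nsmul, chi_dl, chi_dl, chi_dl, H.a0, hvw, smul_zero, zero_add]

lemma exE' (r : ℤ) (hr : 0 ≤ r) :
    ∃ E : Fin 8 → ℤ, Effective E ∧ degHom E = r := by
  refine ⟨r.toNat • dl 0, eff_nsmul (eff_dl 0) _, ?_⟩
  rw [map_nsmul, deg_dl, nsmul_eq_mul]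
  omega

lemma win_big (H : Data G a k) {D : Fin 8 → ℤ} (h : 2 ≤ degHom D) : Winnable G D := by
  rw [win_iff H]
  exact exE H h _

/-- The rank as a function of degree and character value. -/
noncomputable def R (a : Fin 8 → ZMod 24) (k : ZMod 24) (d : ℤ) (x : ZMod 24) : ℤ :=
  if d < 0 then -1 else if d = 0 then (if x = 0 then 0 else -1)
  else if d = 1 then (if ∃ v, a v = x then 0 else -1)
  else if d = 2 then (if x = k then 1 else 0) else d - 2

/-- The rank condition. -/
def RC (G : SimpleGraph (Fin 8)) (D : Fin 8 → ℤ) (r : ℤ) : Prop :=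
  0 ≤ r ∧ ∀ E : Fin 8 → ℤ, Effective E → degSum E = r → Winnable G (D - E)

lemma RC_le (H : Data G a k) {D : Fin 8 → ℤ} {r : ℤ} (h : RC G D r) : r ≤ degHom D := by
  obtain ⟨E, hE, hd⟩ := exE' r h.1
  by_contra hlt
  refine not_win_neg H ?_ (h.2 E hE hd)
  rw [map_sub, hd]
  omega

lemma RC_zero (D : Fin 8 → ℤ) : RC G D 0 ↔ Winnable G D := by
  constructor
  · intro h
    simpa using h.2 0 (fun _ => le_rfl) (by rw [degSum_eq, map_zero])
  · intro h
    refine ⟨le_rfl, fun E hE h0 => ?_⟩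
    rw [eff_zero_of_deg hE h0, sub_zero]
    exact h

lemma RC_one (D : Fin 8 → ℤ) : RC G D 1 ↔ ∀ v, Winnable G (D - dl v) := by
  constructor
  · intro h v
    exact h.2 _ (eff_dl v) (deg_dl v)
  · intro h
    refine ⟨by norm_num, fun E hE h0 => ?_⟩
    obtain ⟨v, rfl⟩ := eff_one hE h0
    exact h v

lemma RC_top (H : Data G a k) {D : Fin 8 → ℤ} (hd : 1 ≤ degHom D) :
    ¬ RC G D (degHom D) := by
  intro h
  obtain hd | hd := hd.eq_or_lt
  · rw [← hd, RC_one] at h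
    have h0 := (win_zero H (by rw [map_sub, deg_dl, ← hd]; rfl)).1 (h 0)
    have h1 := (win_zero H (by rw [map_sub, deg_dl, ← hd]; rfl)).1 (h 1)
    rw [map_sub, chi_dl, sub_eq_zero] at h0 h1
    rw [h0, H.a0, H.a1] at h1
    exact absurd h1 (by decide)
  · obtain ⟨E, hE, he, hx⟩ := exE H (e := degHom D) (by omega) (chi a D - 1)
    have h0 := (win_zero H (by rw [map_sub, he]; ring)).1 (h.2 E hE he)
    rw [map_sub, hx, sub_sub_cancel] at h0
    exact absurd h0 (by decide)

lemma RC_subtop (H : Data G a k) {D : Fin 8 → ℤ} (hd : 3 ≤ degHom D) :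
    ¬ RC G D (degHom D - 1) := by
  intro h
  obtain ⟨t, ht⟩ := H.miss
  obtain ⟨E, hE, he, hx⟩ := exE H (e := degHom D - 1) (by omega) (chi a D - t)
  obtain ⟨v, hv⟩ := (win_one H (by rw [map_sub, he]; ring)).1 (h.2 E hE he)
  rw [map_sub, hx, sub_sub_cancel] at hv
  exact ht v hv

lemma rank_eq (H : Data G a k) (D : Fin 8 → ℤ) :
    bnRank G D = R a k (degHom D) (chi a D) := by
  unfold bnRank
  apply IsGreatest.csSup_eq
  change IsGreatest {r : ℤ | r = -1 ∨ RC G D r} _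
  have hneg : ∀ r, RC G D r → 0 ≤ r := fun r h => h.1
  have hz : RC G D 0 ↔ Winnable G D := RC_zero D
  have hle : ∀ r, RC G D r → r ≤ degHom D := fun r h => RC_le H h
  have htop : ∀ r, RC G D r → 1 ≤ degHom D → r ≠ degHom D := by
    rintro r h h1 rfl
    exact RC_top H h1 h
  unfold R
  split_ifs with h1 h2 h3 h4 h5 h6 h7
  · refine ⟨Or.inl rfl, ?_⟩
    rintro r (hr | hr)
    · omega
    · have := hle r hr
      have := hneg r hr
      omega
  · refine ⟨Or.inr (hz.2 ((win_zero H h2).2 h3)), ?_⟩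
    rintro r (hr | hr)
    · omega
    · have := hle r hr
      omega
  · refine ⟨Or.inl rfl, ?_⟩
    rintro r (hr | hr)
    · omega
    · have h8 := hle r hr
      have h9 := hneg r hr
      have : r = 0 := by omega
      subst this
      exact absurd ((win_zero H h2).1 (hz.1 hr)) h3
  · refine ⟨Or.inr (hz.2 ((win_one H h4).2 h5)), ?_⟩
    rintro r (hr | hr)
    · omega
    · have := hle r hr
      have := htop r hr (by omega)
      omega
  · refine ⟨Or.inl rfl, ?_⟩
    rintro r (hr | hr)
    · omega
    · have h8 := hle r hr
      have h9 := hneg r hr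
      have := htop r hr (by omega)
      have : r = 0 := by omega
      subst this
      exact absurd ((win_one H h4).1 (hz.1 hr)) h5
  · refine ⟨Or.inr ((RC_one D).2 fun v => ?_), ?_⟩
    · rw [win_one H (by rw [map_sub, deg_dl, h6]; rfl), map_sub, chi_dl]
      exact (H.spec _).2 h7 v
    · rintro r (hr | hr)
      · omega
      · have := hle r hr
        have := htop r hr (by omega)
        omega
  · refine ⟨Or.inr (hz.2 (win_big H (by omega))), ?_⟩
    rintro r (hr | hr)
    · omega
    · have h8 := hle r hr
      have h9 := htop r hr (by omega)
      by_contra hlt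
      have : r = 1 := by omega
      subst this
      refine h7 ((H.spec _).1 fun v => ?_)
      have := (RC_one D).1 hr v
      rwa [win_one H (by rw [map_sub, deg_dl, h6]; rfl), map_sub, chi_dl] at this
  · refine ⟨Or.inr ⟨by omega, fun E hE he => win_big H ?_⟩, ?_⟩
    · rw [degSum_eq] at he
      rw [map_sub, he]
      omega
    · rintro r (hr | hr)
      · omega
      · have h8 := hle r hr
        have h9 := htop r hr (by omega)
        by_contra hlt
        have : r = degHom D - 1 := by omega
        subst this
        exact RC_subtop H (by omega) hr

/-- A representative of each class. -/
def rep (d : ℤ) (x : ZMod 24) : Fin 8 → ℤ := (d - (x.val : ℤ)) • dl 0 + (x.val : ℤ) • dl 1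

lemma deg_rep (d : ℤ) (x : ZMod 24) : degHom (rep d x) = d := by
  rw [rep, map_add, map_zsmul, map_zsmul, deg_dl, deg_dl]
  simp

lemma chi_rep (H : Data G a k) (d : ℤ) (x : ZMod 24) : chi a (rep d x) = x := by
  rw [rep, map_add, map_zsmul, map_zsmul, chi_dl, chi_dl, H.a0, H.a1]
  simp

lemma num_eq (H : Data G a k) (d r : ℤ) :
    numClasses G d r = Set.ncard {x : ZMod 24 | R a k d x = r} := by
  have hinj : Function.Injective
      (fun x => QuotientAddGroup.mk' (Principal G) (rep d x)) := by
    intro x y hxy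
    have h := QuotientAddGroup.eq.1 hxy
    rw [H.prin] at h
    have h2 := h.2
    rw [map_add, map_neg, chi_rep H, chi_rep H] at h2
    exact neg_add_eq_zero.1 h2
  rw [← Set.ncard_image_of_injective _ hinj]
  unfold numClasses
  congr 1
  ext c
  constructor
  · rintro ⟨D, rfl, hd, hr⟩
    rw [degSum_eq] at hd
    refine ⟨chi a D, ?_, ?_⟩
    · rw [rank_eq H, hd] at hr
      exact hr
    · refine QuotientAddGroup.eq.2 ?_
      rw [H.prin]
      constructor
      · rw [map_add, map_neg, deg_rep, hd]; ring
      · rw [map_add, map_neg, chi_rep H]; ring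
  · rintro ⟨x, hx, rfl⟩
    refine ⟨rep d x, rfl, deg_rep d x, ?_⟩
    rw [rank_eq H, deg_rep, chi_rep H]
    exact hx

lemma jac_equiv (H : Data G a k) : Nonempty (Jac G ≃+ ZMod 24) := by
  let f : Deg0 (Fin 8) →+ ZMod 24 := (chi a).comp (Deg0 (Fin 8)).subtype
  have hf : Function.Surjective f := by
    intro x
    exact ⟨⟨rep 0 x, deg_rep 0 x⟩, chi_rep H 0 x⟩
  have hk : (Principal G).addSubgroupOf (Deg0 (Fin 8)) = f.ker := by
    ext D
    rw [AddSubgroup.mem_addSubgroupOf, H.prin, AddMonoidHom.mem_ker]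
    exact ⟨fun h => h.2, fun h => ⟨D.2, h⟩⟩
  exact ⟨(QuotientAddGroup.quotientAddEquivOfEq hk).trans
    (QuotientAddGroup.quotientKerEquivOfSurjective f hf)⟩

end

lemma ncard_of_perm {f g : ZMod 24 → ℤ} (e : Equiv.Perm (ZMod 24)) (h : ∀ x, f x = g (e x))
    (r : ℤ) : Set.ncard {x | f x = r} = Set.ncard {x | g x = r} := by
  rw [← Set.ncard_image_of_injective _ e.injective]
  congr 1
  ext y
  constructor
  · rintro ⟨x, hx, rfl⟩
    exact (h x).symm.trans hx
  · intro hy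
    refine ⟨e.symm y, ?_, by simp⟩
    change f _ = r
    rw [h]
    simpa using hy

/-! ### The Tutte polynomial at (3,2) -/

lemma two_pow_comp (A : Set (Sym2 (Fin 8))) :
    2 ^ numComponents (Fin 8) A =
      Fintype.card {s : Fin 8 → Bool // ∀ u v, s(u, v) ∈ A → s u = s v} := by
  let e : ((SimpleGraph.fromEdgeSet A).ConnectedComponent → Bool) ≃
      {s : Fin 8 → Bool // ∀ u v, s(u, v) ∈ A → s u = s v} :=
    { toFun := fun c => ⟨fun v => c ((SimpleGraph.fromEdgeSet A).connectedComponentMk v), by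
        intro u v h
        by_cases huv : u = v
        · rw [huv]
        · exact congrArg c (SimpleGraph.ConnectedComponent.sound
            (SimpleGraph.Adj.reachable (by simp [h, huv])))⟩
      invFun := fun s => SimpleGraph.ConnectedComponent.lift s.1 (by
        intro v w p _
        induction p with
        | nil => rfl
        | cons h p ih =>
          rename_i hp
          exact (s.2 _ _ ((SimpleGraph.fromEdgeSet_adj _).1 h).1).trans (ih hp.of_cons))
      left_inv := by
        intro c
        funext x
        induction x using SimpleGraph.ConnectedComponent.ind
        rfl
      right_inv := by
        intro s
        rfl }
  rw [← Fintype.card_congr e]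
  simp [numComponents, Nat.card_eq_fintype_card]

/-- Number of monochromatic edges among a finite set of edges. -/
def mono (E : Finset (Sym2 (Fin 8))) (s : Fin 8 → Bool) : Finset (Sym2 (Fin 8)) :=
  E.filter fun e => ∀ u v, s(u, v) = e → s u = s v

lemma sum_pow_comp (E : Finset (Sym2 (Fin 8))) :
    ∑ A ∈ E.powerset, 2 ^ numComponents (Fin 8) (A : Set (Sym2 (Fin 8))) =
      ∑ s : Fin 8 → Bool, 2 ^ (mono E s).card := by
  have h1 : ∀ A : Finset (Sym2 (Fin 8)), 2 ^ numComponents (Fin 8) (A : Set (Sym2 (Fin 8))) =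
      ∑ s : Fin 8 → Bool, if ∀ u v, s(u, v) ∈ A → s u = s v then 1 else 0 := by
    intro A
    rw [two_pow_comp, Fintype.card_subtype, Finset.card_filter]
    simp
  simp_rw [h1]
  rw [Finset.sum_comm]
  refine Finset.sum_congr rfl fun s _ => ?_
  rw [← Finset.card_filter, ← Finset.card_powerset]
  congr 1
  ext A
  simp only [Finset.mem_filter, Finset.mem_powerset, mono, Finset.subset_iff]
  constructor
  · rintro ⟨h, h2⟩ e he
    exact ⟨h he, by rintro u v rfl; exact h2 u v he⟩
  · intro h
    exact ⟨fun e he => (h he).1, fun u v he => (h he).2 u v rfl⟩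

/-- The Ising sum of a list of edges. -/
def ising (l : List (Fin 8 × Fin 8)) : ℕ :=
  ∑ s : Fin 8 → Bool, 2 ^ (l.filter fun e => s e.1 = s e.2).length

lemma numComp_pos (A : Set (Sym2 (Fin 8))) : 0 < numComponents (Fin 8) A := by
  unfold numComponents
  have : Nonempty (SimpleGraph.fromEdgeSet A).ConnectedComponent :=
    ⟨SimpleGraph.connectedComponentMk _ 0⟩
  exact Nat.card_pos

lemma tutte_eval {G : SimpleGraph (Fin 8)} (hG : G.Connected) (l : List (Fin 8 × Fin 8))
    (hl : (l.map fun e => s(e.1, e.2)).Nodup)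
    (hE : ∀ u v, G.Adj u v ↔ s(u, v) ∈ l.map fun e => s(e.1, e.2)) :
    2 * MvPolynomial.eval ![3, 2] (tutte G) = (ising l : ℤ) := by
  have hc : numComponents (Fin 8) G.edgeSet = 1 := by
    unfold numComponents
    rw [SimpleGraph.fromEdgeSet_edgeSet, Nat.card_eq_one_iff_unique]
    exact ⟨hG.preconnected.subsingleton_connectedComponent,
      ⟨G.connectedComponentMk 0⟩⟩
  unfold tutte
  rw [hc, map_sum, Finset.mul_sum]
  have h1 : ∀ A ∈ G.edgeFinset.powerset,
      2 * MvPolynomial.eval ![3, 2] ((MvPolynomial.X 0 - 1 : MvPolynomial (Fin 2) ℤ) ^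
        (numComponents (Fin 8) (A : Set (Sym2 (Fin 8))) - 1) *
        (MvPolynomial.X 1 - 1) ^ (numComponents (Fin 8) (A : Set (Sym2 (Fin 8))) + A.card -
          Fintype.card (Fin 8))) = ((2 ^ numComponents (Fin 8) (A : Set (Sym2 (Fin 8))) : ℕ) : ℤ) := by
    intro A _
    obtain ⟨m, hm⟩ := Nat.exists_eq_succ_of_ne_zero
      (numComp_pos (A : Set (Sym2 (Fin 8)))).ne'
    simp [hm]
    ring
  rw [Finset.sum_congr rfl h1, ← Nat.cast_sum, sum_pow_comp]
  refine congrArg Nat.cast ?_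
  unfold ising
  refine Finset.sum_congr rfl fun s _ => ?_
  refine congrArg (fun n => 2 ^ n) ?_
  have h2 : G.edgeFinset = (l.map fun e => s(e.1, e.2)).toFinset := by
    ext e
    induction e with
    | h u v => simp only [SimpleGraph.mem_edgeFinset, SimpleGraph.mem_edgeSet, List.mem_toFinset, hE]
  have h3 : mono G.edgeFinset s =
      ((l.filter fun e => s e.1 = s e.2).map fun e => s(e.1, e.2)).toFinset := by
    rw [h2]
    ext e
    simp only [mono, Finset.mem_filter, List.mem_toFinset, List.mem_map, List.mem_filter]
    constructor
    · rintro ⟨⟨p, hp, rfl⟩, h⟩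
      exact ⟨p, ⟨hp, by simpa using h _ _ rfl⟩, rfl⟩
    · rintro ⟨p, ⟨hp, h⟩, rfl⟩
      refine ⟨⟨p, hp, rfl⟩, ?_⟩
      intro u v huv
      have h' : s p.1 = s p.2 := by simpa using h
      rcases Sym2.eq_iff.1 huv with ⟨rfl, rfl⟩ | ⟨rfl, rfl⟩
      · exact h'
      · exact h'.symm
  rw [h3, List.toFinset_card_of_nodup, List.length_map]
  exact hl.sublist (List.filter_sublist.map _)

/-! ### The two graphs -/

/-- Edges of the theta graph with path lengths 1, 4, 4. -/
def l1 : List (Fin 8 × Fin 8) :=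
  [(0, 1), (1, 2), (2, 3), (3, 4), (4, 5), (5, 6), (6, 7), (7, 0), (0, 4)]

/-- Edges of the theta graph with path lengths 2, 2, 5. -/
def l2 : List (Fin 8 × Fin 8) :=
  [(0, 1), (1, 2), (2, 3), (3, 4), (4, 5), (5, 6), (6, 0), (0, 7), (7, 2)]

/-- Adjacency from a list of edges. -/
def adjB (l : List (Fin 8 × Fin 8)) (u v : Fin 8) : Bool :=
  l.any fun e => (e.1 == u && e.2 == v) || (e.1 == v && e.2 == u)

/-- The theta graph with path lengths 1, 4, 4. -/
def G1 : SimpleGraph (Fin 8) where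
  Adj u v := adjB l1 u v = true
  symm := ⟨by decide⟩
  loopless := ⟨by decide⟩

/-- The theta graph with path lengths 2, 2, 5. -/
def G2 : SimpleGraph (Fin 8) where
  Adj u v := adjB l2 u v = true
  symm := ⟨by decide⟩
  loopless := ⟨by decide⟩

/-- Weights on the first graph. -/
def a1 : Fin 8 → ZMod 24 := ![0, 1, 2, 3, 4, 9, 14, 19]

/-- Weights on the second graph. -/
def a2 : Fin 8 → ZMod 24 := ![0, 1, 2, 16, 6, 20, 10, 13]

lemma lap_eq (G : SimpleGraph (Fin 8)) (l : List (Fin 8 × Fin 8))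
    (h : ∀ u v, G.Adj u v ↔ adjB l u v = true) (f : Fin 8 → ℤ) (v : Fin 8) :
    lap G f v = ∑ w, if adjB l v w = true then f v - f w else 0 := by
  change (G.degree v : ℤ) * f v - ∑ w ∈ G.neighborFinset v, f w = _
  have h2 : G.neighborFinset v = Finset.univ.filter fun w => adjB l v w = true := by
    ext w
    simp [h]
  rw [← SimpleGraph.card_neighborFinset_eq_degree, h2, ← Finset.sum_filter,
    Finset.sum_sub_distrib]
  simp

lemma connected_of (G : SimpleGraph (Fin 8)) (h : ∀ v, G.Reachable 0 v) : G.Connected :=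
  (SimpleGraph.connected_iff _).2 ⟨fun u v => (h u).symm.trans (h v), ⟨0⟩⟩

lemma conn1 : G1.Connected := by
  have e : ∀ u v, adjB l1 u v = true → G1.Reachable u v :=
    fun u v h => SimpleGraph.Adj.reachable h
  have r1 := e 0 1 (by decide)
  have r2 := r1.trans (e 1 2 (by decide))
  have r3 := r2.trans (e 2 3 (by decide))
  have r4 := r3.trans (e 3 4 (by decide))
  have r5 := r4.trans (e 4 5 (by decide))
  have r6 := r5.trans (e 5 6 (by decide))
  have r7 := e 0 7 (by decide)
  refine connected_of _ fun v => ?_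
  fin_cases v
  exacts [SimpleGraph.Reachable.refl _, r1, r2, r3, r4, r5, r6, r7]

lemma conn2 : G2.Connected := by
  have e : ∀ u v, adjB l2 u v = true → G2.Reachable u v :=
    fun u v h => SimpleGraph.Adj.reachable h
  have r1 := e 0 1 (by decide)
  have r2 := r1.trans (e 1 2 (by decide))
  have r3 := r2.trans (e 2 3 (by decide))
  have r4 := r3.trans (e 3 4 (by decide))
  have r5 := r4.trans (e 4 5 (by decide))
  have r6 := r5.trans (e 5 6 (by decide))
  have r7 := e 0 7 (by decide)
  refine connected_of _ fun v => ?_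
  fin_cases v
  exacts [SimpleGraph.Reachable.refl _, r1, r2, r3, r4, r5, r6, r7]

lemma lap1 (f : Fin 8 → ℤ) : lap G1 f = ![3 * f 0 - f 1 - f 7 - f 4, 2 * f 1 - f 0 - f 2,
    2 * f 2 - f 1 - f 3, 2 * f 3 - f 2 - f 4, 3 * f 4 - f 3 - f 5 - f 0,
    2 * f 5 - f 4 - f 6, 2 * f 6 - f 5 - f 7, 2 * f 7 - f 6 - f 0] := by
  funext v
  rw [lap_eq G1 l1 (fun _ _ => Iff.rfl), Fin.sum_univ_eight]
  fin_cases v <;> simp [adjB, l1] <;> ring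

lemma lap2 (f : Fin 8 → ℤ) : lap G2 f = ![3 * f 0 - f 1 - f 6 - f 7, 2 * f 1 - f 0 - f 2,
    3 * f 2 - f 1 - f 3 - f 7, 2 * f 3 - f 2 - f 4, 2 * f 4 - f 3 - f 5,
    2 * f 5 - f 4 - f 6, 2 * f 6 - f 5 - f 0, 2 * f 7 - f 0 - f 2] := by
  funext v
  rw [lap_eq G2 l2 (fun _ _ => Iff.rfl), Fin.sum_univ_eight]
  fin_cases v <;> simp [adjB, l2] <;> ring

lemma chi_zero1 (D : Fin 8 → ℤ) : chi a1 D = 0 ↔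
    (24 : ℤ) ∣ D 1 + 2 * D 2 + 3 * D 3 + 4 * D 4 + 9 * D 5 + 14 * D 6 + 19 * D 7 := by
  refine Iff.trans ?_ (ZMod.intCast_zmod_eq_zero_iff_dvd _ 24)
  simp only [chi, AddMonoidHom.coe_mk, ZeroHom.coe_mk, Fin.sum_univ_eight, a1]
  push_cast
  simp
  ring_nf

lemma chi_zero2 (D : Fin 8 → ℤ) : chi a2 D = 0 ↔
    (24 : ℤ) ∣ D 1 + 2 * D 2 + 16 * D 3 + 6 * D 4 + 20 * D 5 + 10 * D 6 + 13 * D 7 := by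
  refine Iff.trans ?_ (ZMod.intCast_zmod_eq_zero_iff_dvd _ 24)
  simp only [chi, AddMonoidHom.coe_mk, ZeroHom.coe_mk, Fin.sum_univ_eight, a2]
  push_cast
  simp
  ring_nf

lemma deg_eight (D : Fin 8 → ℤ) :
    degHom D = D 0 + D 1 + D 2 + D 3 + D 4 + D 5 + D 6 + D 7 :=
  Fin.sum_univ_eight D

lemma prin1 (D : Fin 8 → ℤ) : D ∈ Principal G1 ↔ degHom D = 0 ∧ chi a1 D = 0 := by
  rw [chi_zero1, deg_eight]
  constructor
  · rintro ⟨f, rfl⟩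
    rw [lap1]
    simp
    constructor
    · ring
    · omega
  · rintro ⟨h0, h1⟩
    obtain ⟨p, hp⟩ : ∃ p : ℤ, 24 * p = -4 * D 0 + 15 * D 1 + 10 * D 2 + 5 * D 3 - D 5
        - 2 * D 6 - 3 * D 7 := by
      have : (24 : ℤ) ∣ -4 * D 0 + 15 * D 1 + 10 * D 2 + 5 * D 3 - D 5
        - 2 * D 6 - 3 * D 7 := by omega
      obtain ⟨p, hp⟩ := this
      exact ⟨p, hp.symm⟩
    obtain ⟨q, hq⟩ : ∃ q : ℤ, q = -D 0 - 5 * p + 3 * D 1 + 2 * D 2 + D 3 := ⟨_, rfl⟩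
    refine ⟨![0, p, 2 * p - D 1, 3 * p - 2 * D 1 - D 2, 4 * p - 3 * D 1 - 2 * D 2 - D 3,
      3 * q - 2 * D 7 - D 6, 2 * q - D 7, q], ?_⟩
    rw [lap1]
    funext v
    fin_cases v <;> simp <;> omega

lemma prin2 (D : Fin 8 → ℤ) : D ∈ Principal G2 ↔ degHom D = 0 ∧ chi a2 D = 0 := by
  rw [chi_zero2, deg_eight]
  constructor
  · rintro ⟨f, rfl⟩
    rw [lap2]
    simp
    constructor
    · ring
    · omega
  · rintro ⟨h0, h1⟩
    obtain ⟨p, hp⟩ : ∃ p : ℤ, 24 * p = 7 * D 1 - 5 * D 7 - 10 * D 0 -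
        2 * (4 * D 6 + 3 * D 5 + 2 * D 4 + D 3) := by
      have : (24 : ℤ) ∣ 7 * D 1 - 5 * D 7 - 10 * D 0 -
        2 * (4 * D 6 + 3 * D 5 + 2 * D 4 + D 3) := by omega
      obtain ⟨p, hp⟩ := this
      exact ⟨p, hp.symm⟩
    obtain ⟨q, hq⟩ : ∃ q : ℤ, 2 * q = 2 * p - D 1 + D 7 := by
      have : (2 : ℤ) ∣ 2 * p - D 1 + D 7 := by omega
      obtain ⟨q, hq⟩ := this
      exact ⟨q, hq.symm⟩
    obtain ⟨r, hr⟩ : ∃ r : ℤ, r = -D 0 - p - q := ⟨_, rfl⟩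
    refine ⟨![0, p, 2 * p - D 1, 4 * r - 3 * D 6 - 2 * D 5 - D 4, 3 * r - 2 * D 6 - D 5,
      2 * r - D 6, r, q], ?_⟩
    rw [lap2]
    funext v
    fin_cases v <;> simp <;> omega

lemma data1 : Data G1 a1 4 where
  prin := prin1
  two := by decide
  a0 := rfl
  a1 := rfl
  miss := ⟨5, by decide⟩
  spec := by decide

lemma data2 : Data G2 a2 2 where
  prin := prin2
  two := by decide
  a0 := rfl
  a1 := rfl
  miss := ⟨3, by decide⟩
  spec := by decide

/-- A permutation carrying the first weight set to the second. -/
def sig : Equiv.Perm (ZMod 24) :=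
  Equiv.swap 3 16 * Equiv.swap 4 6 * Equiv.swap 9 20 * Equiv.swap 14 10 * Equiv.swap 19 13

lemma sig_spec : ∀ x, (∃ v, a1 v = x) ↔ ∃ v, a2 v = sig x := by decide

lemma swap_spec : ∀ x : ZMod 24, x = 4 ↔ Equiv.swap (4 : ZMod 24) 2 x = 2 := by decide

lemma same : SameZeta G1 G2 := by
  intro d r
  rw [num_eq data1, num_eq data2]
  by_cases h1 : d = 1
  · refine ncard_of_perm sig (fun x => ?_) r
    subst h1
    have := sig_spec x
    simp only [R]
    norm_num
    simp only [this]
  by_cases h2 : d = 2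
  · refine ncard_of_perm (Equiv.swap 4 2) (fun x => ?_) r
    subst h2
    have := swap_spec x
    simp only [R]
    norm_num
    simp only [this]
  · refine ncard_of_perm (Equiv.refl _) (fun x => ?_) r
    simp only [R, h1, h2, if_false]
    rfl

lemma edge_set_eq {G : SimpleGraph (Fin 8)} (l : List (Fin 8 × Fin 8))
    (hl : (l.map fun e => s(e.1, e.2)).Nodup)
    (hE : ∀ u v, G.Adj u v ↔ s(u, v) ∈ l.map fun e => s(e.1, e.2)) :
    edgeCount G = l.length := by
  have h2 : G.edgeSet = ((l.map fun e => s(e.1, e.2)).toFinset : Set (Sym2 (Fin 8))) := by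
    ext e
    induction e with
    | h u v => simp only [SimpleGraph.mem_edgeSet, Finset.mem_coe, List.mem_toFinset, hE]
  unfold edgeCount
  rw [h2, Nat.card_coe_set_eq, Set.ncard_coe_finset, List.toFinset_card_of_nodup hl,
    List.length_map]

lemma adj_iff1 : ∀ u v, G1.Adj u v ↔ s(u, v) ∈ l1.map fun e => s(e.1, e.2) := by
  change ∀ u v, adjB l1 u v = true ↔ _
  decide

lemma adj_iff2 : ∀ u v, G2.Adj u v ↔ s(u, v) ∈ l2.map fun e => s(e.1, e.2) := by
  change ∀ u v, adjB l2 u v = true ↔ _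
  decide

lemma nodup1 : (l1.map fun e => s(e.1, e.2)).Nodup := by decide

lemma nodup2 : (l2.map fun e => s(e.1, e.2)).Nodup := by decide

lemma ising_ne : ising l1 ≠ ising l2 := by decide +kernel

/-- There are connected simple graphs with the same number of vertices and edges,
the same two-variable zeta function and isomorphic Jacobians, whose Tutte polynomials
are different. -/
theorem exists_sameZeta_isoJac_differentTutte :
    ∃ (n : ℕ) (G G' : SimpleGraph (Fin n)),
      G.Connected ∧ G'.Connected ∧
      edgeCount G = edgeCount G' ∧
      SameZeta G G' ∧
      Nonempty (Jac G ≃+ Jac G') ∧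
      tutte G ≠ tutte G' := by
  refine ⟨8, G1, G2, conn1, conn2, ?_, same, ?_, ?_⟩
  · rw [edge_set_eq l1 nodup1 adj_iff1, edge_set_eq l2 nodup2 adj_iff2]
    rfl
  · obtain ⟨e1⟩ := jac_equiv data1
    obtain ⟨e2⟩ := jac_equiv data2
    exact ⟨e1.trans e2.symm⟩
  · intro h
    have h1 := tutte_eval conn1 l1 nodup1 adj_iff1
    have h2 := tutte_eval conn2 l2 nodup2 adj_iff2
    rw [h, h2] at h1
    exact ising_ne (by exact_mod_cast h1.symm)

end BNGraph
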